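/- Let S be a subdivided star and let S' be the tree obtained from S by attaching a path on 3 vertices to S, i.e., by adding a new path with 3 vertices and joining one of its endpoints by an edge either to a leaf of S or to the central vertex of S. Then the Grundy value of the 0.33 game on S' equals the Grundy value of the 0.33 game on S. -/

import Mathlib

open SimpleGraph

/-- The minimum excludant of a set of naturals. -/
noncomputable def mex (A : Set ℕ) : ℕ := sInf {n : ℕ | n ∉ A}

/-- The connected component (as a vertex set) of `x` in the subgraph of `G`
induced on the vertex set `s`. -/
def compOf {V : Type} (G : SimpleGraph V) (s : Set V) (x : V) : Set V :=
  {v | ∃ (hx : x ∈ s) (hv : v ∈ s), (G.induce s).Reachable ⟨x, hx⟩ ⟨v, hv⟩}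

/-- A legal move of the 0.33 game on the graph `G`, from the position (vertex set) `s`
to the position `t`: one removes either a single vertex of `s`, or two vertices of `s`
that are adjacent in `G`, and the removed set may not disconnect the connected component
`H` (of the subgraph induced on `s`) containing it: `H` minus the removed set must be
connected or empty. -/
def ValidMove {V : Type} [DecidableEq V] (G : SimpleGraph V) (s t : Finset V) : Prop :=
  t ⊆ s ∧
  ((∃ x ∈ s, s \ t = {x}) ∨ (∃ x ∈ s, ∃ y ∈ s, G.Adj x y ∧ s \ t = {x, y})) ∧
  ∀ x ∈ s \ t,
    (compOf G (↑s) x \ (↑(s \ t) : Set V) = ∅ ∨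
     (G.induce (compOf G (↑s) x \ (↑(s \ t) : Set V))).Connected)

theorem ValidMove.card_lt {V : Type} [DecidableEq V] {G : SimpleGraph V} {s t : Finset V}
    (h : ValidMove G s t) : t.card < s.card := by
  apply Finset.card_lt_card
  rw [Finset.ssubset_iff_of_subset h.1]
  rcases h.2.1 with ⟨x, hx, he⟩ | ⟨x, hx, y, hy, _, he⟩
  · refine ⟨x, hx, fun hxt => ?_⟩
    have hmem : x ∈ s \ t := by rw [he]; exact Finset.mem_singleton_self x
    exact (Finset.mem_sdiff.mp hmem).2 hxt
  · refine ⟨x, hx, fun hxt => ?_⟩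
    have hmem : x ∈ s \ t := by rw [he]; simp
    exact (Finset.mem_sdiff.mp hmem).2 hxt

/-- The Grundy value of the 0.33 game on the graph `G` played on the vertex set `s`. -/
noncomputable def grundy {V : Type} [DecidableEq V] (G : SimpleGraph V) (s : Finset V) : ℕ :=
  mex {n : ℕ | ∃ t : {t : Finset V // ValidMove G s t}, grundy G t.1 = n}
termination_by s.card
decreasing_by exact t.2.card_lt

/-! ### Concrete graphs

`pathG` played on `Finset.range n` is the path `P_n`;
`cycleG n` played on `Finset.range n` is the cycle `C_n`.

Subdivided stars and bistars are encoded on vertex type `ℕ × ℕ`.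
A subdivided star is given by the list `L` of the numbers of vertices of its arms
(`some L`), or is the empty graph (`none`).
In the bistar `S₁ •m• S₂`, the center of `S₁` is `(0,0)`, the middle path consists of
`(1,1), …, (1,m)` where `(1,m)` is the center of `S₂` (when `m = 0` the two centers are
identified to `(0,0)`), the `i`-th arm of `S₁` consists of `(2i+2, 1), …, (2i+2, ℓᵢ)`,
and the `i`-th arm of `S₂` consists of `(2i+3, 1), …, (2i+3, ℓ'ᵢ)`.  If `S₂` is the
empty graph, its center `(1,m)` is removed (so `S₁` just gets an extra arm with `m-1`
vertices), and similarly for `S₁`. -/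

def pathG : SimpleGraph ℕ := SimpleGraph.fromRel (fun u v => v = u + 1)

def cycleG (n : ℕ) : SimpleGraph ℕ := SimpleGraph.fromRel (fun u v => v % n = (u + 1) % n)

def bistarG (m : ℕ) : SimpleGraph (ℕ × ℕ) :=
  SimpleGraph.fromRel (fun u v =>
    (u = (0, 0) ∧ v = (1, 1)) ∨
    (u.1 = 1 ∧ v.1 = 1 ∧ v.2 = u.2 + 1) ∨
    (u = (0, 0) ∧ 2 ≤ v.1 ∧ v.1 % 2 = 0 ∧ v.2 = 1) ∨
    (u = (if m = 0 then ((0 : ℕ), (0 : ℕ)) else (1, m)) ∧ 3 ≤ v.1 ∧ v.1 % 2 = 1 ∧ v.2 = 1) ∨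
    (u.1 = v.1 ∧ 2 ≤ u.1 ∧ v.2 = u.2 + 1))

def armVerts (base : ℕ) (L : List ℕ) : Finset (ℕ × ℕ) :=
  (Finset.range L.length).biUnion
    (fun i => (Finset.range (L.getD i 0)).image (fun j => (2 * i + base, j + 1)))

def bistarVerts (S1 S2 : Option (List ℕ)) (m : ℕ) : Finset (ℕ × ℕ) :=
  (match S1 with
   | none => (∅ : Finset (ℕ × ℕ))
   | some L => insert ((0 : ℕ), (0 : ℕ)) (armVerts 2 L)) ∪
  (match S2 with
   | none => (Finset.range (m - 1)).image (fun p => ((1 : ℕ), p + 1))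
   | some L => ((Finset.range m).image (fun p => ((1 : ℕ), p + 1))) ∪ armVerts 3 L)

/-- Grundy value of the 0.33 game on the subdivided bistar `S₁ •m• S₂`
(where `S₁`, `S₂` are subdivided stars or the empty graph). -/
noncomputable def bistarGrundyO (S1 S2 : Option (List ℕ)) (m : ℕ) : ℕ :=
  grundy (bistarG m) (bistarVerts S1 S2 m)

/-- Grundy value of the 0.33 game on the subdivided bistar `S_{L₁} •m• S_{L₂}`. -/
noncomputable def bistarGrundy (L1 L2 : List ℕ) (m : ℕ) : ℕ :=
  bistarGrundyO (some L1) (some L2) m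

/-- Grundy value of the 0.33 game on the subdivided star `S_L`. -/
noncomputable def starGrundy (L : List ℕ) : ℕ := bistarGrundy L [] 0

/-- Grundy value of the 0.33 game on a subdivided star or the empty graph. -/
noncomputable def starGrundyO (S : Option (List ℕ)) : ℕ := bistarGrundyO S (some []) 0

/-- Every arm of the subdivided star has at least one vertex. -/
def armsPos (L : List ℕ) : Prop := ∀ ℓ ∈ L, 1 ≤ ℓ

/-! ### Minimum excludants and Grundy values -/

theorem mex_notMem_of_finite {A : Set ℕ} (hA : A.Finite) : mex A ∉ A :=
  Nat.sInf_mem (s := {n : ℕ | n ∉ A}) hA.infinite_compl.nonempty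

theorem mex_le_of_notMem {A : Set ℕ} {n : ℕ} (h : n ∉ A) : mex A ≤ n := Nat.sInf_le h

section Connectivity

variable {V : Type} {G : SimpleGraph V}

/-- A property preserved along the edges of a preconnected induced subgraph holds at all of its
vertices as soon as it holds at one of them. -/
theorem forall_of_preconnected_induce {s : Set V} (hs : (G.induce s).Preconnected)
    (p : V → Prop) (hp : ∀ u ∈ s, ∀ v ∈ s, G.Adj u v → p u → p v) {u v : V} (hu : u ∈ s)
    (hv : v ∈ s) (hpu : p u) : p v := by
  obtain ⟨w⟩ := hs ⟨u, hu⟩ ⟨v, hv⟩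
  have key : ∀ {a b : s}, (G.induce s).Walk a b → p a → p b := by
    intro a b w
    induction w with
    | nil => exact id
    | cons hab _ ih => exact fun ha => ih (hp _ (Subtype.property _) _ (Subtype.property _) hab ha)
  exact key w hpu

theorem compOf_eq_self {s : Set V} (hs : (G.induce s).Preconnected) {x : V} (hx : x ∈ s) :
    compOf G s x = s := by
  ext v
  exact ⟨fun ⟨_, hv, _⟩ => hv, fun hv => ⟨hx, hv, hs _ _⟩⟩

theorem preconnected_induce_empty : (G.induce (↑(∅ : Finset V) : Set V)).Preconnected :=
  fun a => (Finset.notMem_empty _ a.2).elim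

end Connectivity

section Game

variable {V : Type} [DecidableEq V] {G : SimpleGraph V} {s t : Finset V}

theorem grundy_eq_mex (G : SimpleGraph V) (s : Finset V) :
    grundy G s = mex {n : ℕ | ∃ t : {t : Finset V // ValidMove G s t}, grundy G t.1 = n} := by
  rw [grundy]

theorem finite_grundy_options (G : SimpleGraph V) (s : Finset V) :
    {n : ℕ | ∃ t : {t : Finset V // ValidMove G s t}, grundy G t.1 = n}.Finite := by
  refine ((s.powerset.finite_toSet).image (grundy G)).subset ?_
  rintro n ⟨⟨t, ht⟩, rfl⟩
  exact ⟨t, by simpa using ht.1, rfl⟩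

theorem ValidMove.grundy_ne (h : ValidMove G s t) : grundy G t ≠ grundy G s := by
  intro he
  refine mex_notMem_of_finite (finite_grundy_options G s) ?_
  rw [← grundy_eq_mex]
  exact ⟨⟨t, h⟩, he⟩

theorem grundy_le_of_forall_ne {n : ℕ} (h : ∀ t, ValidMove G s t → grundy G t ≠ n) :
    grundy G s ≤ n := by
  rw [grundy_eq_mex]
  refine mex_le_of_notMem ?_
  rintro ⟨⟨t, ht⟩, he⟩
  exact h t ht he

theorem le_grundy_of_forall_exists {n : ℕ}
    (h : ∀ v < n, ∃ t, ValidMove G s t ∧ grundy G t = v) : n ≤ grundy G s := by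
  by_contra! hlt
  obtain ⟨t, ht, he⟩ := h _ hlt
  exact ht.grundy_ne he

theorem ValidMove.card_add (h : ValidMove G s t) :
    t.card + 1 = s.card ∨ t.card + 2 = s.card := by
  have hc := Finset.card_sdiff_add_card_eq_card h.1
  rcases h.2.1 with ⟨x, -, he⟩ | ⟨x, -, y, -, hxy, he⟩
  · rw [he, Finset.card_singleton] at hc
    omega
  · rw [he, Finset.card_pair hxy.ne] at hc
    omega

/-- If every option has Grundy value equal to its size modulo 3, and all smaller residues are
realised, then the position has Grundy value equal to its size modulo 3. -/
theorem grundy_eq_card_mod_three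
    (h : ∀ t, ValidMove G s t → grundy G t = t.card % 3)
    (hex : ∀ v < s.card % 3, ∃ t, ValidMove G s t ∧ t.card % 3 = v) :
    grundy G s = s.card % 3 := by
  refine le_antisymm (grundy_le_of_forall_ne fun t ht => ?_)
    (le_grundy_of_forall_exists fun v hv => ?_)
  · rw [h t ht]
    have := ht.card_add
    omega
  · obtain ⟨t, ht, he⟩ := hex v hv
    exact ⟨t, ht, (h t ht).trans he⟩

/-! ### Moves between connected positions -/

theorem validMove_iff_of_preconnected (hs : (G.induce (s : Set V)).Preconnected) :
    ValidMove G s t ↔ t ⊆ s ∧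
      ((∃ x ∈ s, s \ t = {x}) ∨ (∃ x ∈ s, ∃ y ∈ s, G.Adj x y ∧ s \ t = {x, y})) ∧
      (G.induce (t : Set V)).Preconnected := by
  refine and_congr_right fun hts => and_congr_right fun hrem => ?_
  have hd : (s : Set V) \ (↑(s \ t) : Set V) = t := by
    rw [← Finset.coe_sdiff, Finset.sdiff_sdiff_eq_self hts]
  obtain ⟨x, hx⟩ : (s \ t).Nonempty := by
    rcases hrem with ⟨x, -, he⟩ | ⟨x, -, y, -, -, he⟩ <;> simp [he]
  have hcomp : ∀ y ∈ s \ t, compOf G (↑s) y \ (↑(s \ t) : Set V) = t := fun y hy => by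
    rw [compOf_eq_self hs (Finset.mem_coe.2 (Finset.mem_sdiff.1 hy).1), hd]
  constructor
  · intro h
    have := h x hx
    rw [hcomp x hx] at this
    rcases this with h0 | h0
    · rw [h0]
      exact fun a => a.2.elim
    · exact h0.preconnected
  · intro h y hy
    rw [hcomp y hy]
    rcases (t : Set V).eq_empty_or_nonempty with h0 | ⟨z, hz⟩
    · exact Or.inl h0
    · exact Or.inr ((connected_iff _).2 ⟨h, ⟨⟨z, hz⟩⟩⟩)

theorem validMove_insert {x : V} (hx : x ∉ t)
    (hs : (G.induce (↑(insert x t) : Set V)).Preconnected)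
    (ht : (G.induce (t : Set V)).Preconnected) : ValidMove G (insert x t) t := by
  refine (validMove_iff_of_preconnected hs).2 ⟨Finset.subset_insert _ _, Or.inl ⟨x, by simp, ?_⟩, ht⟩
  ext v
  simp only [Finset.mem_sdiff, Finset.mem_insert, Finset.mem_singleton]
  grind

theorem validMove_insert_insert {x y : V} (hx : x ∉ t) (hy : y ∉ t) (hxy : G.Adj x y)
    (hs : (G.induce (↑(insert x (insert y t)) : Set V)).Preconnected)
    (ht : (G.induce (t : Set V)).Preconnected) : ValidMove G (insert x (insert y t)) t := by
  refine (validMove_iff_of_preconnected hs).2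
    ⟨by grind, Or.inr ⟨x, by simp, y, by simp, hxy, ?_⟩, ht⟩
  ext v
  simp only [Finset.mem_sdiff, Finset.mem_insert, Finset.mem_singleton]
  grind

theorem validMove_empty_of_card_le_two (hs : (G.induce (s : Set V)).Preconnected)
    (hne : s.Nonempty) (hc : s.card ≤ 2) : ValidMove G s ∅ := by
  obtain h1 | h2 : s.card = 1 ∨ s.card = 2 := by
    have := hne.card_pos
    omega
  · obtain ⟨x, rfl⟩ := Finset.card_eq_one.1 h1
    exact validMove_insert (Finset.notMem_empty _) hs preconnected_induce_empty
  · obtain ⟨x, y, hxy, rfl⟩ := Finset.card_eq_two.1 h2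
    have hadj : G.Adj x y := by
      by_contra hn
      refine hxy (forall_of_preconnected_induce hs (x = ·) ?_ (u := x) (v := y)
        (by simp) (by simp) rfl)
      rintro u hu v hv huv rfl
      simp only [Finset.coe_insert, Finset.coe_singleton, Set.mem_insert_iff,
        Set.mem_singleton_iff] at hv
      rcases hv with rfl | rfl
      · rfl
      · exact (hn huv).elim
    exact validMove_insert_insert (Finset.notMem_empty _) (Finset.notMem_empty _) hadj hs
      preconnected_induce_empty

end Game

/-! ### Segments of an arm -/

theorem bistarG_zero_adj {u v : ℕ × ℕ} (hu : u.1 ≠ 1) (hv : v.1 ≠ 1) :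
    (bistarG 0).Adj u v ↔
      (u = (0, 0) ∧ 2 ≤ v.1 ∧ v.2 = 1) ∨ (v = (0, 0) ∧ 2 ≤ u.1 ∧ u.2 = 1) ∨
      (u.1 = v.1 ∧ 2 ≤ u.1 ∧ (v.2 = u.2 + 1 ∨ u.2 = v.2 + 1)) := by
  obtain ⟨a, b⟩ := u
  obtain ⟨c, d⟩ := v
  simp only [bistarG, fromRel_adj, Prod.mk.injEq, ne_eq, if_true] at *
  constructor
  · rintro ⟨-, (h | h | h | h | h) | (h | h | h | h | h)⟩ <;> omega
  · rintro (⟨⟨rfl, rfl⟩, h1, rfl⟩ | ⟨⟨rfl, rfl⟩, h1, rfl⟩ | ⟨rfl, h1, rfl | rfl⟩)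
    · exact ⟨by omega, Or.inl (by omega)⟩
    · exact ⟨by omega, Or.inr (by omega)⟩
    · exact ⟨by omega, Or.inl (by omega)⟩
    · exact ⟨by omega, Or.inr (by omega)⟩

/-- The vertices at heights `a, …, b - 1` of the column `c`. -/
def armSegment (c a b : ℕ) : Finset (ℕ × ℕ) := (Finset.Ico a b).image (fun j => (c, j))

theorem mem_armSegment {c a b : ℕ} {v : ℕ × ℕ} :
    v ∈ armSegment c a b ↔ v.1 = c ∧ a ≤ v.2 ∧ v.2 < b := by
  obtain ⟨x, y⟩ := v
  simp only [armSegment, Finset.mem_image, Finset.mem_Ico, Prod.mk.injEq]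
  grind

theorem card_armSegment (c a b : ℕ) : (armSegment c a b).card = b - a := by
  rw [armSegment, Finset.card_image_of_injective _ (fun x y h => (Prod.mk.inj h).2), Nat.card_Ico]

theorem armSegment_succ {c a b : ℕ} (h : a ≤ b) :
    armSegment c a (b + 1) = insert (c, b) (armSegment c a b) := by
  ext ⟨x, y⟩
  simp only [mem_armSegment, Finset.mem_insert, Prod.mk.injEq]
  omega

theorem preconnected_armSegment {c : ℕ} (hc : 2 ≤ c) (a b : ℕ) :
    ((bistarG 0).induce (↑(armSegment c a b) : Set (ℕ × ℕ))).Preconnected := by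
  have key : ∀ n (h : (c, a + n) ∈ (↑(armSegment c a b) : Set (ℕ × ℕ)))
      (h0 : (c, a) ∈ (↑(armSegment c a b) : Set (ℕ × ℕ))),
      ((bistarG 0).induce (↑(armSegment c a b) : Set (ℕ × ℕ))).Reachable ⟨_, h⟩ ⟨_, h0⟩ := by
    intro n
    induction n with
    | zero => exact fun _ _ => Reachable.refl _
    | succ n ih =>
      intro h h0
      have hlt := (mem_armSegment.1 (Finset.mem_coe.1 h)).2.2
      have hn : (c, a + n) ∈ (↑(armSegment c a b) : Set (ℕ × ℕ)) :=
        Finset.mem_coe.2 (mem_armSegment.2 ⟨rfl, Nat.le_add_right _ _, by dsimp only at *; omega⟩)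
      refine Reachable.trans (Adj.reachable ?_) (ih hn h0)
      rw [comap_adj]
      exact (bistarG_zero_adj (u := (c, a + (n + 1))) (v := (c, a + n)) (by dsimp only; omega)
        (by dsimp only; omega)).2 (Or.inr (Or.inr ⟨rfl, hc, Or.inr rfl⟩))
  have base : ∀ u : (↑(armSegment c a b) : Set (ℕ × ℕ)),
      ∃ h0, ((bistarG 0).induce (↑(armSegment c a b) : Set (ℕ × ℕ))).Reachable u ⟨(c, a), h0⟩ := by
    rintro ⟨⟨x, y⟩, hu⟩
    have hu' := mem_armSegment.1 (Finset.mem_coe.1 hu)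
    obtain ⟨rfl, h1, h2⟩ := hu'
    obtain ⟨n, rfl⟩ := Nat.exists_eq_add_of_le h1
    exact ⟨Finset.mem_coe.2 (mem_armSegment.2 ⟨rfl, le_rfl, by dsimp only at *; omega⟩), key n hu _⟩
  intro u v
  obtain ⟨_, hu⟩ := base u
  obtain ⟨_, hv⟩ := base v
  exact hu.trans hv.symm

theorem exists_eq_armSegment {c : ℕ} (hc : 2 ≤ c) {t : Finset (ℕ × ℕ)}
    (hcol : ∀ v ∈ t, v.1 = c) (ht : ((bistarG 0).induce (↑t : Set (ℕ × ℕ))).Preconnected) :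
    ∃ a b, t = armSegment c a b := by
  rcases t.eq_empty_or_nonempty with rfl | hne
  · exact ⟨0, 0, rfl⟩
  obtain ⟨u, hu, hmin⟩ := t.exists_min_image Prod.snd hne
  obtain ⟨w, hw, hmax⟩ := t.exists_max_image Prod.snd hne
  refine ⟨u.2, w.2 + 1, ?_⟩
  ext v
  rw [mem_armSegment]
  refine ⟨fun hv => ⟨hcol v hv, hmin v hv, Nat.lt_succ_of_le (hmax v hv)⟩, ?_⟩
  rintro ⟨h1, h2, h3⟩
  by_contra hv
  have hne : ∀ x ∈ t, x.2 ≠ v.2 := fun x hx he => hv (by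
    rwa [show v = x from Prod.ext (h1.trans (hcol x hx).symm) he.symm])
  have := forall_of_preconnected_induce ht (fun x => x.2 < v.2) (u := u) (v := w) ?_ hu hw
    (lt_of_le_of_ne h2 (hne u hu))
  · exact hne w hw (by omega)
  · intro x hx y hy hxy hlt
    have hcx := hcol x hx
    have hcy := hcol y hy
    have := hne y hy
    rw [bistarG_zero_adj (by omega) (by omega)] at hxy
    simp only [Prod.ext_iff] at hxy
    omega

theorem grundy_armSegment {c : ℕ} (hc : 2 ≤ c) (a b : ℕ) :
    grundy (bistarG 0) (armSegment c a b) = (armSegment c a b).card % 3 := by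
  induction hn : (armSegment c a b).card using Nat.strong_induction_on generalizing a b with
  | _ n ih =>
    subst hn
    have hpre := preconnected_armSegment hc a b
    refine grundy_eq_card_mod_three ?_ ?_
    · intro t ht
      have hlt := ht.card_lt
      obtain ⟨hts, -, htp⟩ := (validMove_iff_of_preconnected hpre).1 ht
      obtain ⟨a', b', rfl⟩ := exists_eq_armSegment hc
        (fun v hv => (mem_armSegment.1 (hts hv)).1) htp
      exact ih _ hlt a' b' rfl
    · intro v hv
      rw [card_armSegment] at hv
      obtain ⟨n, rfl⟩ : ∃ n, b = a + n := ⟨b - a, by omega⟩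
      obtain h1 | h2 : (∃ m, n = m + 1 ∧ m % 3 = v) ∨ (∃ m, n = m + 2 ∧ m % 3 = v) := by
        by_cases h : v + 1 = n % 3
        · exact Or.inl ⟨n - 1, by omega, by omega⟩
        · exact Or.inr ⟨n - 2, by omega, by omega⟩
      · obtain ⟨m, rfl, hm⟩ := h1
        refine ⟨armSegment c a (a + m), ?_, by rw [card_armSegment]; omega⟩
        rw [← add_assoc, armSegment_succ (by omega)] at hpre ⊢
        exact validMove_insert (by simp [mem_armSegment]) hpre (preconnected_armSegment hc _ _)
      · obtain ⟨m, rfl, hm⟩ := h2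
        refine ⟨armSegment c a (a + m), ?_, by rw [card_armSegment]; omega⟩
        rw [show a + (m + 2) = a + m + 1 + 1 by omega, armSegment_succ (by omega),
          armSegment_succ (by omega)] at hpre ⊢
        refine validMove_insert_insert (by simp [mem_armSegment]) (by simp [mem_armSegment]) ?_ hpre
          (preconnected_armSegment hc _ _)
        refine (bistarG_zero_adj ?_ ?_).2 ?_ <;> dsimp only <;> omega

/-! ### Subdivided stars -/

/-- The subdivided star whose `i`-th arm has `f i` vertices (arms may be empty). -/
def starVerts (f : ℕ →₀ ℕ) : Finset (ℕ × ℕ) :=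
  insert (0, 0) (f.support.biUnion fun i => armSegment (2 * i + 2) 1 (f i + 1))

theorem mem_starVerts {f : ℕ →₀ ℕ} {v : ℕ × ℕ} :
    v ∈ starVerts f ↔ v = (0, 0) ∨ ∃ i, v.1 = 2 * i + 2 ∧ 1 ≤ v.2 ∧ v.2 ≤ f i := by
  simp only [starVerts, Finset.mem_insert, Finset.mem_biUnion, Finsupp.mem_support_iff,
    mem_armSegment, Nat.lt_succ_iff]
  refine or_congr_right (exists_congr fun i => ?_)
  omega

theorem fst_ne_one_of_mem_starVerts {f : ℕ →₀ ℕ} {v : ℕ × ℕ} (hv : v ∈ starVerts f) :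
    v.1 ≠ 1 := by
  rcases mem_starVerts.1 hv with rfl | ⟨i, hi, -⟩
  · exact zero_ne_one
  · omega

theorem center_mem_starVerts (f : ℕ →₀ ℕ) : (0, 0) ∈ starVerts f :=
  mem_starVerts.2 (Or.inl rfl)

theorem mk_mem_starVerts {f : ℕ →₀ ℕ} {i j : ℕ} :
    (2 * i + 2, j) ∈ starVerts f ↔ 1 ≤ j ∧ j ≤ f i := by
  rw [mem_starVerts]
  constructor
  · rintro (h | ⟨k, h1, h2⟩)
    · simp at h
    · obtain rfl : i = k := by dsimp only at h1; omega
      exact h2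
  · exact fun h => Or.inr ⟨i, rfl, h⟩

theorem preconnected_starVerts (f : ℕ →₀ ℕ) :
    ((bistarG 0).induce (↑(starVerts f) : Set (ℕ × ℕ))).Preconnected := by
  set S : Set (ℕ × ℕ) := ↑(starVerts f) with hS
  have h0 : (0, 0) ∈ S := center_mem_starVerts f
  have key : ∀ i j (h : (2 * i + 2, j + 1) ∈ S),
      ((bistarG 0).induce S).Reachable ⟨_, h⟩ ⟨_, h0⟩ := by
    intro i j
    induction j with
    | zero =>
      refine fun h => Adj.reachable ?_
      rw [comap_adj]
      refine (bistarG_zero_adj ?_ ?_).2 ?_ <;> simp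
    | succ j ih =>
      intro h
      have hj : (2 * i + 2, j + 1) ∈ S := by
        simp only [hS, Finset.mem_coe, mk_mem_starVerts] at h ⊢
        omega
      refine Reachable.trans (Adj.reachable ?_) (ih hj)
      rw [comap_adj]
      refine (bistarG_zero_adj ?_ ?_).2 ?_ <;> simp
  have base : ∀ u : S, ((bistarG 0).induce S).Reachable u ⟨_, h0⟩ := by
    rintro ⟨⟨x, y⟩, hu⟩
    rcases mem_starVerts.1 (Finset.mem_coe.1 hu) with h | ⟨i, hi, hy, -⟩
    · obtain ⟨rfl, rfl⟩ := Prod.mk.inj h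
      exact Reachable.refl _
    · dsimp only at hi hy
      subst hi
      obtain ⟨j, rfl⟩ := Nat.exists_eq_add_of_le' hy
      exact key i j hu
  exact fun u v => (base u).trans (base v).symm

theorem starVerts_add_single (g : ℕ →₀ ℕ) (i : ℕ) :
    starVerts (g + Finsupp.single i 1) = insert (2 * i + 2, g i + 1) (starVerts g) := by
  ext ⟨x, y⟩
  by_cases hx : ∃ j, x = 2 * j + 2
  · obtain ⟨j, rfl⟩ := hx
    simp only [mk_mem_starVerts, Finset.mem_insert, Finsupp.add_apply, Finsupp.single_apply,
      Prod.mk.injEq]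
    split_ifs with h
    · subst h
      omega
    · omega
  · have h1 : ∀ j, x ≠ 2 * j + 2 := fun j h => hx ⟨j, h⟩
    simp [mem_starVerts, h1]

theorem notMem_starVerts_succ (g : ℕ →₀ ℕ) (i : ℕ) : (2 * i + 2, g i + 1) ∉ starVerts g := by
  rw [mk_mem_starVerts]
  omega

theorem validMove_starVerts_one (g : ℕ →₀ ℕ) (i : ℕ) :
    ValidMove (bistarG 0) (starVerts (g + Finsupp.single i 1)) (starVerts g) := by
  have h := preconnected_starVerts (g + Finsupp.single i 1)
  rw [starVerts_add_single] at h ⊢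
  exact validMove_insert (notMem_starVerts_succ g i) h (preconnected_starVerts g)

theorem validMove_starVerts_two (g : ℕ →₀ ℕ) (i : ℕ) :
    ValidMove (bistarG 0) (starVerts (g + Finsupp.single i 2)) (starVerts g) := by
  have h := preconnected_starVerts (g + Finsupp.single i 2)
  rw [show g + Finsupp.single i 2 = g + Finsupp.single i 1 + Finsupp.single i 1 by
    rw [add_assoc, ← Finsupp.single_add], starVerts_add_single, starVerts_add_single] at h ⊢
  refine validMove_insert_insert ?_ (notMem_starVerts_succ g i) ?_ h (preconnected_starVerts g)
  · simp [mk_mem_starVerts]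
  · refine (bistarG_zero_adj ?_ ?_).2 ?_ <;> simp

theorem validMove_starVerts {k : ℕ} (hk : k = 1 ∨ k = 2) (g : ℕ →₀ ℕ) (i : ℕ) :
    ValidMove (bistarG 0) (starVerts (g + Finsupp.single i k)) (starVerts g) := by
  rcases hk with rfl | rfl
  · exact validMove_starVerts_one g i
  · exact validMove_starVerts_two g i

theorem card_starVerts_add_single (g : ℕ →₀ ℕ) (i k : ℕ) :
    (starVerts (g + Finsupp.single i k)).card = (starVerts g).card + k := by
  induction k with
  | zero => simp
  | succ k ih =>
    rw [Finsupp.single_add, ← add_assoc, starVerts_add_single,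
      Finset.card_insert_of_notMem (notMem_starVerts_succ _ i), ih, add_assoc]

theorem exists_eq_add_single {f : ℕ →₀ ℕ} {i k : ℕ} (h : k ≤ f i) :
    ∃ g, f = g + Finsupp.single i k :=
  ⟨f - Finsupp.single i k, (tsub_add_cancel_of_le (by simpa using h)).symm⟩

theorem card_starVerts_le (f : ℕ →₀ ℕ) {m : ℕ} (h : ∀ i, f i ≤ m) :
    (starVerts f).card ≤ f.support.card * m + 1 := by
  refine (Finset.card_insert_le _ _).trans (Nat.succ_le_succ ?_)
  refine Finset.card_biUnion_le_card_mul _ _ _ fun i _ => ?_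
  rw [card_armSegment]
  exact h i

theorem card_support_lt_card_starVerts (f : ℕ →₀ ℕ) :
    f.support.card < (starVerts f).card := by
  have hinj : Function.Injective fun i : ℕ => (2 * i + 2, 1) := fun i j h => by
    simpa using h
  rw [← Finset.card_image_of_injective f.support hinj]
  refine Finset.card_lt_card ((Finset.ssubset_iff_of_subset ?_).2
    ⟨(0, 0), center_mem_starVerts f, by simp⟩)
  rw [Finset.image_subset_iff]
  exact fun i hi => mk_mem_starVerts.2 ⟨le_rfl, Nat.pos_of_ne_zero (Finsupp.mem_support_iff.1 hi)⟩

/-- Removing a segment from an arm while keeping the rest connected to the center means that the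
segment lies at the end of the arm. -/
theorem eq_starVerts_of_sdiff_eq_armSegment {f : ℕ →₀ ℕ} {t : Finset (ℕ × ℕ)} {i j k : ℕ}
    (hk : 1 ≤ k) (hts : t ⊆ starVerts f)
    (ht : ((bistarG 0).induce (↑t : Set (ℕ × ℕ))).Preconnected) (h0 : (0, 0) ∈ t)
    (hrem : starVerts f \ t = armSegment (2 * i + 2) j (j + k)) :
    ∃ g, f = g + Finsupp.single i k ∧ t = starVerts g := by
  have hmem : ∀ v, v ∈ t ↔ v ∈ starVerts f ∧ v ∉ armSegment (2 * i + 2) j (j + k) := by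
    intro v
    rw [← hrem, Finset.mem_sdiff]
    exact ⟨fun h => ⟨hts h, fun h' => h'.2 h⟩, fun ⟨h, h'⟩ => by tauto⟩
  have hsub : ∀ l, j ≤ l → l < j + k → 1 ≤ l ∧ l ≤ f i := fun l h1 h2 => by
    have : (2 * i + 2, l) ∈ starVerts f \ t := hrem ▸ mem_armSegment.2 ⟨rfl, h1, h2⟩
    exact mk_mem_starVerts.1 (Finset.mem_sdiff.1 this).1
  have hj := hsub j le_rfl (by omega)
  have hjk := hsub (j + k - 1) (by omega) (by omega)
  have hend : j + k = f i + 1 := by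
    by_contra hne
    have hin : (2 * i + 2, j + k) ∈ t := by
      rw [hmem, mk_mem_starVerts, mem_armSegment]
      dsimp only
      omega
    have := forall_of_preconnected_induce ht (fun v => v.1 = 2 * i + 2 ∧ j + k ≤ v.2)
      ?_ hin h0 ⟨rfl, le_rfl⟩
    · simp at this
    · rintro u hu v hv huv ⟨h1, h2⟩
      have hv1 := fst_ne_one_of_mem_starVerts (hts hv)
      rw [bistarG_zero_adj (by omega) hv1] at huv
      have := ((hmem v).1 hv).2
      rw [mem_armSegment] at this
      simp only [Prod.ext_iff] at huv
      omega
  obtain ⟨g, rfl⟩ := exists_eq_add_single (f := f) (i := i) (k := k) (by omega)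
  refine ⟨g, rfl, ?_⟩
  ext ⟨x, y⟩
  rw [hmem, mem_armSegment]
  by_cases hx : ∃ l, x = 2 * l + 2
  · obtain ⟨l, rfl⟩ := hx
    simp only [mk_mem_starVerts, Finsupp.add_apply, Finsupp.single_apply] at hend ⊢
    rw [if_true] at hend
    split_ifs with h
    · subst h
      omega
    · omega
  · have h1 : ∀ l, x ≠ 2 * l + 2 := fun l h => hx ⟨l, h⟩
    simp [mem_starVerts, h1]

theorem ValidMove.exists_eq_starVerts {f : ℕ →₀ ℕ} {t : Finset (ℕ × ℕ)}
    (h : ValidMove (bistarG 0) (starVerts f) t) (h0 : (0, 0) ∈ t) :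
    ∃ g i k, (k = 1 ∨ k = 2) ∧ f = g + Finsupp.single i k ∧ t = starVerts g := by
  obtain ⟨hts, hrem, ht⟩ := (validMove_iff_of_preconnected (preconnected_starVerts f)).1 h
  have harm : ∀ x ∈ starVerts f \ t, ∃ i j, x = (2 * i + 2, j) := by
    rintro ⟨x, y⟩ hx
    rw [Finset.mem_sdiff] at hx
    rcases mem_starVerts.1 hx.1 with he | ⟨i, hi, -⟩
    · exact (hx.2 (he ▸ h0)).elim
    · exact ⟨i, y, Prod.ext hi rfl⟩
  have hpair : ∀ i j, ({(2 * i + 2, j), (2 * i + 2, j + 1)} : Finset (ℕ × ℕ)) =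
      armSegment (2 * i + 2) j (j + 2) := by
    intro i j
    ext ⟨x, y⟩
    simp only [mem_armSegment, Finset.mem_insert, Finset.mem_singleton, Prod.mk.injEq]
    omega
  rcases hrem with ⟨x, -, he⟩ | ⟨x, -, y, -, hxy, he⟩
  · obtain ⟨i, j, rfl⟩ := harm x (by simp [he])
    obtain ⟨g, hg⟩ := eq_starVerts_of_sdiff_eq_armSegment (i := i) (j := j) le_rfl hts ht h0 (by
      rw [he]
      simp [armSegment])
    exact ⟨g, i, 1, Or.inl rfl, hg⟩
  · obtain ⟨i, j, rfl⟩ := harm x (by simp [he])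
    obtain ⟨i', j', rfl⟩ := harm y (by simp [he])
    rw [bistarG_zero_adj (by dsimp only; omega) (by dsimp only; omega)] at hxy
    simp only [Prod.mk.injEq] at hxy
    obtain rfl : i = i' := by omega
    obtain rfl | rfl : j' = j + 1 ∨ j = j' + 1 := by omega
    · obtain ⟨g, hg⟩ := eq_starVerts_of_sdiff_eq_armSegment (by norm_num) hts ht h0
        (he.trans (hpair i j))
      exact ⟨g, i, 2, Or.inr rfl, hg⟩
    · obtain ⟨g, hg⟩ := eq_starVerts_of_sdiff_eq_armSegment (by norm_num) hts ht h0
        (he.trans ((Finset.pair_comm _ _).trans (hpair i j')))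
      exact ⟨g, i, 2, Or.inr rfl, hg⟩

theorem ValidMove.exists_eq_armSegment_of_center_notMem {f : ℕ →₀ ℕ} {t : Finset (ℕ × ℕ)}
    (h : ValidMove (bistarG 0) (starVerts f) t) (h0 : (0, 0) ∉ t) :
    f.support.card ≤ 2 ∧ ∃ c a b, 2 ≤ c ∧ t = armSegment c a b := by
  obtain ⟨hts, hrem, ht⟩ := (validMove_iff_of_preconnected (preconnected_starVerts f)).1 h
  have hmem : ∀ v ∈ t, ∃ i, v.1 = 2 * i + 2 := fun v hv => by
    rcases mem_starVerts.1 (hts hv) with rfl | ⟨i, hi, -⟩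
    · exact (h0 hv).elim
    · exact ⟨i, hi⟩
  obtain ⟨i, hi⟩ : ∃ i, ∀ v ∈ t, v.1 = 2 * i + 2 := by
    rcases t.eq_empty_or_nonempty with rfl | ⟨u, hu⟩
    · exact ⟨0, by simp⟩
    · obtain ⟨i, hi⟩ := hmem u hu
      refine ⟨i, fun v hv => forall_of_preconnected_induce ht (fun v => v.1 = 2 * i + 2)
        ?_ hu hv hi⟩
      intro x hx y hy hxy hxi
      obtain ⟨l, hl⟩ := hmem x hx
      obtain ⟨m, hm⟩ := hmem y hy
      rw [bistarG_zero_adj (by omega) (by omega)] at hxy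
      simp only [Prod.ext_iff] at hxy
      omega
  refine ⟨?_, 2 * i + 2, ?_⟩
  · obtain ⟨y, hy⟩ : ∃ y, starVerts f \ t ⊆ {(0, 0), y} := by
      have hc : (0, 0) ∈ starVerts f \ t := Finset.mem_sdiff.2 ⟨center_mem_starVerts f, h0⟩
      rcases hrem with ⟨x, -, he⟩ | ⟨x, -, y, -, -, he⟩
      · exact ⟨x, by rw [he]; simp⟩
      · rw [he, Finset.mem_insert, Finset.mem_singleton] at hc
        rcases hc with hc | hc
        · exact ⟨y, by rw [he, hc]⟩
        · exact ⟨x, by rw [he, hc, Finset.pair_comm]⟩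
    have hsupp : f.support ⊆ {i, (y.1 - 2) / 2} := by
      intro l hl
      have hl' := Finsupp.mem_support_iff.1 hl
      have hin : (2 * l + 2, 1) ∈ starVerts f := mk_mem_starVerts.2 (by omega)
      rw [Finset.mem_insert, Finset.mem_singleton]
      by_cases hlt : (2 * l + 2, 1) ∈ t
      · have := hi _ hlt
        dsimp only at this
        omega
      · have := hy (Finset.mem_sdiff.2 ⟨hin, hlt⟩)
        simp only [Finset.mem_insert, Finset.mem_singleton, Prod.ext_iff] at this
        omega
    exact (Finset.card_le_card hsupp).trans Finset.card_le_two
  · obtain ⟨a, b, hab⟩ := exists_eq_armSegment (by omega) hi ht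
    exact ⟨a, b, by omega, hab⟩

/-- Smaller residues modulo 3 are realised by shortening an arm of a subdivided path. -/
theorem exists_shorten_card_mod_three {f : ℕ →₀ ℕ} (hf : f.support.card ≤ 2)
    (hN : 3 ≤ (starVerts f).card) {v : ℕ} (hv : v < (starVerts f).card % 3) :
    ∃ g i k, (k = 1 ∨ k = 2) ∧ f = g + Finsupp.single i k ∧ (starVerts g).card % 3 = v := by
  obtain ⟨k, hk, hkv, m, hm, hmN⟩ : ∃ k, (k = 1 ∨ k = 2) ∧
      (∀ n, n + k = (starVerts f).card → n % 3 = v) ∧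
      ∃ m, m + 1 = k ∧ 2 * m + 1 < (starVerts f).card := by
    by_cases h : v + 1 = (starVerts f).card % 3
    · exact ⟨1, Or.inl rfl, by omega, 0, by omega⟩
    · exact ⟨2, Or.inr rfl, by omega, 1, by omega⟩
  obtain ⟨i, hi⟩ : ∃ i, k ≤ f i := by
    by_contra! hlt
    have h1 := card_starVerts_le f (m := m) (fun i => by have := hlt i; omega)
    have h2 := Nat.mul_le_mul_right m hf
    omega
  obtain ⟨g, rfl⟩ := exists_eq_add_single hi
  exact ⟨g, i, k, hk, rfl, hkv _ (card_starVerts_add_single g i k).symm⟩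

theorem card_support_le_add (g h : ℕ →₀ ℕ) : g.support.card ≤ (g + h).support.card :=
  Finset.card_le_card fun i hi => by
    simp only [Finsupp.mem_support_iff, Finsupp.add_apply] at hi ⊢
    omega

theorem grundy_starVerts_of_card_support_le_two {f : ℕ →₀ ℕ} (hf : f.support.card ≤ 2) :
    grundy (bistarG 0) (starVerts f) = (starVerts f).card % 3 := by
  induction hn : (starVerts f).card using Nat.strong_induction_on generalizing f with
  | _ n ih =>
    subst hn
    refine grundy_eq_card_mod_three ?_ ?_
    · intro t ht
      by_cases h0 : (0, 0) ∈ t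
      · have hlt := ht.card_lt
        obtain ⟨g, i, k, -, rfl, rfl⟩ := ht.exists_eq_starVerts h0
        exact ih _ hlt ((card_support_le_add _ _).trans hf) rfl
      · obtain ⟨-, c, a, b, hc, rfl⟩ := ht.exists_eq_armSegment_of_center_notMem h0
        exact grundy_armSegment hc a b
    · intro v hv
      by_cases hN : 3 ≤ (starVerts f).card
      · obtain ⟨g, i, k, hk, rfl, hg⟩ := exists_shorten_card_mod_three hf hN hv
        exact ⟨starVerts g, validMove_starVerts hk g i, hg⟩
      · rcases v with _ | v
        · exact ⟨∅, validMove_empty_of_card_le_two (preconnected_starVerts f)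
            ⟨_, center_mem_starVerts f⟩ (by omega), rfl⟩
        · obtain ⟨i, hi⟩ : ∃ i, 1 ≤ f i := by
            by_contra! hlt
            have := card_starVerts_le f (m := 0) (fun i => by have := hlt i; omega)
            omega
          obtain ⟨g, rfl⟩ := exists_eq_add_single hi
          refine ⟨starVerts g, validMove_starVerts (Or.inl rfl) g i, ?_⟩
          rw [card_starVerts_add_single] at hN hv
          omega

theorem grundy_starVerts_add_three (f : ℕ →₀ ℕ) (i : ℕ) :
    grundy (bistarG 0) (starVerts (f + Finsupp.single i 3)) = grundy (bistarG 0) (starVerts f) := by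
  induction hn : (starVerts f).card using Nat.strong_induction_on generalizing f with
  | _ n ih =>
    subst hn
    by_cases hsupp : (f + Finsupp.single i 3).support.card ≤ 2
    · rw [grundy_starVerts_of_card_support_le_two hsupp,
        grundy_starVerts_of_card_support_le_two ((card_support_le_add _ _).trans hsupp),
        card_starVerts_add_single, Nat.add_mod_right]
    have hshort : ∀ g j k, (k = 1 ∨ k = 2) → f = g + Finsupp.single j k →
        ValidMove (bistarG 0) (starVerts (f + Finsupp.single i 3))
          (starVerts (g + Finsupp.single i 3)) ∧
        grundy (bistarG 0) (starVerts (g + Finsupp.single i 3)) =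
          grundy (bistarG 0) (starVerts g) := by
      rintro g j k hk rfl
      refine ⟨?_, ih _ (validMove_starVerts hk g j).card_lt g rfl⟩
      rw [add_right_comm]
      exact validMove_starVerts hk _ j
    refine le_antisymm (grundy_le_of_forall_ne fun t ht => ?_) ?_
    · by_cases h0 : (0, 0) ∈ t
      · obtain ⟨g, j, k, hk, he, rfl⟩ := ht.exists_eq_starVerts h0
        by_cases hij : j = i
        · subst hij
          obtain rfl : g = f + Finsupp.single j (3 - k) := by
            refine add_right_cancel (b := Finsupp.single j k) ?_
            rw [← he, add_assoc, ← Finsupp.single_add]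
            congr 2
            omega
          exact (validMove_starVerts (by omega) f j).grundy_ne.symm
        · have hval := DFunLike.congr_fun he
          obtain ⟨g, rfl⟩ := exists_eq_add_single (f := g) (i := i) (k := 3) (by
            have := hval i
            simp only [Finsupp.add_apply, Finsupp.single_apply, if_neg hij] at this
            simp at this
            omega)
          have hf : f = g + Finsupp.single j k := by
            rw [add_right_comm] at he
            exact add_right_cancel he
          rw [(hshort g j k hk hf).2, hf]
          exact (validMove_starVerts hk g j).grundy_ne
      · exact (hsupp (ht.exists_eq_armSegment_of_center_notMem h0).1).elim
    · by_cases hf : f.support.card ≤ 2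
      · rw [grundy_starVerts_of_card_support_le_two hf]
        have hN : 3 ≤ (starVerts f).card := by
          have h1 := card_support_lt_card_starVerts f
          have h2 := (Finset.card_le_card Finsupp.support_add).trans
            (Finset.card_union_le f.support (Finsupp.single i 3).support)
          rw [Finsupp.support_single i (by norm_num), Finset.card_singleton] at h2
          omega
        refine le_grundy_of_forall_exists fun v hv => ?_
        obtain ⟨g, j, k, hk, he, hg⟩ := exists_shorten_card_mod_three hf hN hv
        obtain ⟨hmove, hval⟩ := hshort g j k hk he
        refine ⟨_, hmove, ?_⟩
        rw [hval, grundy_starVerts_of_card_support_le_two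
          ((card_support_le_add g (Finsupp.single j k)).trans (he ▸ hf)), hg]
      · refine grundy_le_of_forall_ne fun t ht => ?_
        by_cases h0 : (0, 0) ∈ t
        · obtain ⟨g, j, k, hk, he, rfl⟩ := ht.exists_eq_starVerts h0
          obtain ⟨hmove, hval⟩ := hshort g j k hk he
          exact hval ▸ hmove.grundy_ne
        · exact (hf (ht.exists_eq_armSegment_of_center_notMem h0).1).elim

theorem bistarVerts_eq_starVerts {L : List ℕ} {f : ℕ →₀ ℕ} (h : ∀ i, f i = L.getD i 0) :
    bistarVerts (some L) (some []) 0 = starVerts f := by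
  ext ⟨x, y⟩
  have hlen : ∀ i, f i ≠ 0 → i < L.length := fun i hi => by
    by_contra hlt
    exact hi (by rw [h, List.getD_eq_default _ _ (by omega)])
  simp only [bistarVerts, armVerts, mem_starVerts, Finset.mem_union, Finset.mem_insert,
    Finset.mem_biUnion, Finset.mem_range, Finset.mem_image, ← h, Prod.mk.injEq, List.length_nil]
  constructor
  · rintro ((h0 | ⟨i, -, j, hj, rfl, rfl⟩) | ⟨_, h0, -⟩ | ⟨_, h0, -⟩)
    · exact Or.inl h0
    · exact Or.inr ⟨i, rfl, by omega, by omega⟩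
    · omega
    · omega
  · rintro (h0 | ⟨i, rfl, h1, h2⟩)
    · exact Or.inl (Or.inl h0)
    · exact Or.inl (Or.inr ⟨i, hlen i (by omega), y - 1, by omega, rfl, by omega⟩)

theorem starGrundy_eq_grundy_starVerts {L : List ℕ} {f : ℕ →₀ ℕ} (h : ∀ i, f i = L.getD i 0) :
    starGrundy L = grundy (bistarG 0) (starVerts f) := by
  rw [starGrundy, bistarGrundy, bistarGrundyO, bistarVerts_eq_starVerts h]

/-- Attaching a path on 3 vertices to the central vertex of a subdivided star
(adding a new arm with 3 vertices), or to a leaf of the star (extending an arm by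
3 vertices), does not change the Grundy value of the 0.33 game. -/
theorem grundy_star_attach_P3 (L : List ℕ) (hL : armsPos L) :
    starGrundy (L ++ [3]) = starGrundy L ∧
    ∀ i < L.length, starGrundy (L.set i (L.getD i 0 + 3)) = starGrundy L := by
  have hf : ∀ i, L.toFinsupp i = L.getD i 0 := fun i => L.toFinsupp_apply i
  rw [starGrundy_eq_grundy_starVerts hf]
  refine ⟨?_, fun i hi => ?_⟩
  · rw [← grundy_starVerts_add_three _ L.length]
    refine starGrundy_eq_grundy_starVerts fun j => ?_
    rw [Finsupp.add_apply, hf, Finsupp.single_apply]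
    grind
  · rw [← grundy_starVerts_add_three _ i]
    refine starGrundy_eq_grundy_starVerts fun j => ?_
    rw [Finsupp.add_apply, hf, Finsupp.single_apply]
    grind
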